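/- There exists a constant c such that for every integer t and every string (or tuple) y with |y| < 2^t/2 − c: m(y | t) ≤ c · |T_t(y)| · 2^{−2^t}, where T_t(y) = {s : C_V(y, s) ≤ 2^t}. -/

import Mathlib

open scoped Classical ENNReal

/-- Binary strings. -/
abbrev BStr := List Bool

/-- Plain Kolmogorov complexity of `x` with respect to a decompressor `D`
(a partial function from binary strings to binary strings):
the minimal length of a description `p` with `D p = x`. -/
noncomputable def plainC (D : BStr →. BStr) (x : BStr) : ℕ :=
  sInf {n | ∃ p : BStr, p.length = n ∧ x ∈ D p}

/-- Conditional complexity of `x` given `y` with respect to a two-argument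
decompressor `D` (first argument: program, second: condition). -/
noncomputable def condC (D : BStr → BStr →. BStr) (x y : BStr) : ℕ :=
  sInf {n | ∃ p : BStr, p.length = n ∧ x ∈ D p y}

/-- A fixed computable encoding of natural numbers as binary strings. -/
def natStr (n : ℕ) : BStr := Nat.bits n

/-- A fixed computable pairing function on binary strings. -/
def pairStr (x y : BStr) : BStr := natStr (Encodable.encode (x, y))

/-- A fixed computable encoding of triples of binary strings. -/
def tripStr (x y z : BStr) : BStr := natStr (Encodable.encode (x, y, z))

/-- An optimal (universal) plain decompressor `V`: a partial computable
decompressor whose complexity function is minimal up to an additive constant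
among all partial computable decompressors. -/
structure OptimalDecompressor where
  V : BStr →. BStr
  partrec : Partrec V
  onto : ∀ x : BStr, ∃ p : BStr, x ∈ V p
  optimal : ∀ D : BStr →. BStr, Partrec D → ∃ M : ℕ, ∀ x : BStr,
    (∃ p : BStr, x ∈ D p) → plainC V x ≤ plainC D x + M

/-- A universal two-argument decompressor for conditional plain complexity. -/
structure CondOptimalDecompressor where
  Vc : BStr → BStr →. BStr
  partrec : Partrec₂ Vc
  onto : ∀ x y : BStr, ∃ p : BStr, x ∈ Vc p y
  optimal : ∀ D : BStr → BStr →. BStr, Partrec₂ D → ∃ M : ℕ, ∀ x y : BStr,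
    (∃ p : BStr, x ∈ D p y) → condC Vc x y ≤ condC D x y + M

/-- A two-argument decompressor is prefix-free if for each condition `y`
its domain (in the program argument) is prefix-free. -/
def PrefixFreeDom (D : BStr → BStr →. BStr) : Prop :=
  ∀ y p q : BStr, (D p y).Dom → (D q y).Dom → p <+: q → p = q

/-- A universal prefix-free conditional decompressor, defining conditional
prefix complexity `K(x | y)`. -/
structure UniversalPrefixDecompressor where
  D : BStr → BStr →. BStr
  partrec : Partrec₂ D
  prefixFree : PrefixFreeDom D
  onto : ∀ x y : BStr, ∃ p : BStr, x ∈ D p y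
  universal : ∀ D' : BStr → BStr →. BStr, Partrec₂ D' → PrefixFreeDom D' →
    ∃ c : ℕ, ∀ x y : BStr, (∃ p : BStr, x ∈ D' p y) →
      condC D x y ≤ condC D' x y + c

/-- Conditional prefix complexity `K(x | y)` with respect to a universal
prefix-free conditional decompressor `U`. -/
noncomputable def K (U : UniversalPrefixDecompressor) (x y : BStr) : ℕ := condC U.D x y

/-- The canonical enumeration of all pairs `(x, k)` with `C_V(x) ≤ k`,
obtained by dovetailing the computations of `V` on all programs: a computable
listing whose range is exactly the set of such pairs. -/
structure CanonicalEnum (V : BStr →. BStr) where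
  e : ℕ → Option (BStr × ℕ)
  computable : Computable e
  mem_iff : ∀ x : BStr, ∀ k : ℕ, (∃ t, e t = some (x, k)) ↔ plainC V x ≤ k

/-- The moment of first appearance of string `x` in the canonical enumeration
as a pair `(x, k)` with `k ≤ n`. -/
noncomputable def strFirst {V : BStr →. BStr} (E : CanonicalEnum V) (x : BStr) (n : ℕ) : ℕ :=
  sInf {t | ∃ k ≤ n, E.e t = some (x, k)}

/-- `w` is the last string of complexity at most `n` (i.e. `w = w_n`):
it has `C_V(w) ≤ n` and every string of complexity at most `n` appears
(as a pair with bound `≤ n`) no later than `w` does. -/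
def IsLastSimple (O : OptimalDecompressor) (E : CanonicalEnum O.V) (n : ℕ) (w : BStr) : Prop :=
  plainC O.V w ≤ n ∧ ∀ x : BStr, plainC O.V x ≤ n → strFirst E x n ≤ strFirst E w n

/-- The extension set `T_t(y) = { s : C_V(y, s) ≤ 2^t }`. -/
def Tset (O : OptimalDecompressor) (t : ℕ) (y : BStr) : Set BStr :=
  {s | plainC O.V (pairStr y s) ≤ 2 ^ t}

/-- The relaxed extension set `T_t^δ(y) = { s : C_V(y, s) ≤ 2^t + δ }`. -/
def TsetR (O : OptimalDecompressor) (t δ : ℕ) (y : BStr) : Set BStr :=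
  {s | plainC O.V (pairStr y s) ≤ 2 ^ t + δ}

/-- The "past" set `St^w_t(y)`: extensions `s` with `C_V(y, s) ≤ 2^t` whose
pair appears in the canonical enumeration (with bound `≤ 2^t`) strictly
before `w = w_n` appears (with bound `≤ n`). -/
def StSet (O : OptimalDecompressor) (E : CanonicalEnum O.V) (t n : ℕ) (w : BStr)
    (y : BStr) : Set BStr :=
  {s | plainC O.V (pairStr y s) ≤ 2 ^ t ∧
       strFirst E (pairStr y s) (2 ^ t) < strFirst E w n}

/-- The tower sequence `a_0 = 1`, `a_{i+1} = 2^{a_i}`. -/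
def tower : ℕ → ℕ
  | 0 => 1
  | i + 1 => 2 ^ tower i

/-- `qt` is a structural witness for `q` relative to `n` with constant `c₀`:
it is short, effectively encodes `q`, and satisfies the complexity
decomposition `K(q̃ | n) = K(q̃, α, K(q̃, α | q) | n) + O(1)` where `α = K(q̃ | n)`. -/
def StructuralWitness (Oc : CondOptimalDecompressor) (U : UniversalPrefixDecompressor)
    (c₀ n q : ℕ) (qt : BStr) : Prop :=
  qt.length ≤ c₀ * Nat.log 2 q ∧
  condC Oc.Vc (natStr q) qt ≤ c₀ ∧
  K U qt (natStr n) ≤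
      K U (tripStr qt (natStr (K U qt (natStr n)))
        (natStr (K U (pairStr qt (natStr (K U qt (natStr n)))) (natStr q)))) (natStr n) + c₀ ∧
  K U (tripStr qt (natStr (K U qt (natStr n)))
        (natStr (K U (pairStr qt (natStr (K U qt (natStr n)))) (natStr q)))) (natStr n) ≤
      K U qt (natStr n) + c₀

/-- A lower semicomputable conditional semimeasure: a nonnegative function
`μ(x | y)` with `Σ_x μ(x | y) ≤ 1` for each `y`, approximable from below by a
computable monotone sequence of dyadic rationals. -/
structure CondSemimeasure where
  μ : BStr → BStr → ℝ≥0∞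
  approx : ℕ → BStr → BStr → ℕ
  approx_computable : Computable fun p : ℕ × BStr × BStr => approx p.1 p.2.1 p.2.2
  approx_mono : ∀ x y : BStr, Monotone fun t => (approx t x y : ℝ≥0∞) / 2 ^ t
  approx_sup : ∀ x y : BStr, (⨆ t, (approx t x y : ℝ≥0∞) / 2 ^ t) = μ x y
  sum_le_one : ∀ y : BStr, (∑' x : BStr, μ x y) ≤ 1

/-- A universal conditional semimeasure `m(x | y)`: a lower semicomputable
conditional semimeasure that multiplicatively dominates every lower
semicomputable conditional semimeasure. -/
structure UniversalCondSemimeasure extends CondSemimeasure where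
  dominates : ∀ ν : CondSemimeasure, ∃ c : ℕ, 0 < c ∧
    ∀ x y : BStr, ν.μ x y ≤ (c : ℝ≥0∞) * μ x y

def wIdx (p : BStr) : ℕ := p.foldr (fun b n => cond b (2 * n + 1) (2 * n)) 0

theorem wIdx_bits (n : ℕ) : wIdx (Nat.bits n) = n := by
  induction n using Nat.binaryRec' with
  | zero => simp [wIdx]
  | bit b n h ih =>
    rw [Nat.bits_append_bit _ _ h]
    have : wIdx (b :: n.bits) = cond b (2 * wIdx n.bits + 1) (2 * wIdx n.bits) := rfl
    rw [this, ih]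
    cases b <;> simp [Nat.bit]

theorem natStr_inj : Function.Injective natStr := fun a b h => by
  have := congrArg wIdx h
  simpa [natStr, wIdx_bits] using this

theorem pairStr_inj {x y x' y' : BStr} (h : pairStr x y = pairStr x' y') : x = x' ∧ y = y' := by
  have := Encodable.encode_injective (natStr_inj h)
  simpa using this

theorem wIdx_surj (L : ℕ) : ∀ i < 2 ^ L, ∃ p : BStr, p.length = L ∧ wIdx p = i := by
  induction L with
  | zero => intro i hi; exact ⟨[], rfl, by simp at hi; simp [wIdx, hi]⟩
  | succ L ih =>
    intro i hi
    obtain ⟨p, hp, hp'⟩ := ih (i / 2) (by rw [pow_succ] at hi; omega)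
    refine ⟨decide (i % 2 = 1) :: p, by simp [hp], ?_⟩
    have : wIdx (decide (i % 2 = 1) :: p) =
      cond (decide (i % 2 = 1)) (2 * wIdx p + 1) (2 * wIdx p) := rfl
    rw [this, hp']
    by_cases h : i % 2 = 1
    · simp [h]; omega
    · simp [h]; omega

theorem wIdx_primrec : Primrec wIdx := by
  have hd : Primrec (fun q : BStr × (Bool × ℕ) => 2 * q.2.2) :=
    Primrec.nat_mul.comp (Primrec.const 2) (Primrec.snd.comp Primrec.snd)
  exact Primrec.list_foldr (f := fun p : BStr => p) (g := fun _ => 0)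
    (h := fun _ q => cond q.1 (2 * q.2 + 1) (2 * q.2)) Primrec.id (Primrec.const 0)
    (Primrec.cond (Primrec.fst.comp Primrec.snd) (Primrec.succ.comp hd) hd).to₂

theorem natStr_primrec : Primrec natStr := by
  have h : Primrec₂ (fun (_ : Unit) (n : ℕ) => natStr n) := by
    refine Primrec.nat_strong_rec _
      (g := fun _ l => if l.length = 0 then some [] else
        (l[l.length.div2]?).map (fun r => l.length.bodd :: r)) ?_ ?_
    · have hl : Primrec (fun q : Unit × List BStr => q.2.length) :=
        Primrec.list_length.comp Primrec.snd
      refine Primrec.ite (Primrec.eq.comp hl (Primrec.const 0)) (Primrec.const _) ?_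
      refine Primrec.option_map
        (Primrec.list_getElem?.comp Primrec.snd (Primrec.nat_div2.comp hl)) ?_
      exact (Primrec.list_cons.comp (Primrec.nat_bodd.comp (hl.comp Primrec.fst)) Primrec.snd).to₂
    · intro _ n
      by_cases hn : n = 0
      · subst hn; simp [natStr]
      · have h2 : n.div2 < n := by rw [Nat.div2_val]; omega
        have h3 : n.bits = n.bodd :: n.div2.bits := by
          conv_lhs => rw [← Nat.bit_bodd_div2 n]
          apply Nat.bits_append_bit
          intro h0
          have := Nat.bodd_add_div2 n
          rw [h0] at this
          cases hb : n.bodd <;> simp [hb] at this ⊢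
          omega
        simp [hn, h2, natStr, h3]
  exact h.comp (Primrec.const ()) Primrec.id

theorem pairStr_primrec : Primrec₂ pairStr :=
  natStr_primrec.comp (Primrec.encode.comp (Primrec.id (α := BStr × BStr)))

theorem wpow_primrec : Primrec₂ (fun a b : ℕ => a ^ b) :=
  Primrec₂.unpaired'.1 Nat.Primrec.pow

def wA (M : CondSemimeasure) (s n t : ℕ) : ℕ :=
  Option.casesOn (Encodable.decode₂ BStr n) 0 (fun y => M.approx s y (natStr t))

def wP (M : CondSemimeasure) (L s n j : ℕ) : Bool :=
  decide ((j + 1) * 2 ^ s ≤ wA M s n (natStr (L - 1)).length * 2 ^ L)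

def wF (M : CondSemimeasure) (L a : ℕ) : Bool :=
  wP M L a.unpair.1 a.unpair.2.unpair.1 a.unpair.2.unpair.2 &&
    (decide (a.unpair.1 = 0) ||
      !wP M L (a.unpair.1 - 1) a.unpair.2.unpair.1 a.unpair.2.unpair.2)

def wCount (M : CondSemimeasure) (L a : ℕ) : ℕ :=
  Nat.rec 0 (fun b ih => ih + cond (wF M L b) 1 0) a

def wOut (a : ℕ) : BStr :=
  pairStr ((Encodable.decode₂ BStr a.unpair.2.unpair.1).getD [])
    (natStr a.unpair.2.unpair.2)

def wTest (M : CondSemimeasure) (p : BStr) (a : ℕ) : Bool :=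
  wF M p.length a && decide (wCount M p.length a = wIdx p)

def wD (M : CondSemimeasure) (p : BStr) : Part BStr :=
  (Nat.rfind (fun a => Part.some (wTest M p a))).map wOut

theorem wA_comp1 :
    Computable (fun q : (ℕ × ℕ × ℕ) × BStr => (q.1.1, q.2, natStr q.1.2.2)) :=
  Computable.pair (Computable.fst.comp Computable.fst)
    (Computable.pair Computable.snd (natStr_primrec.to_comp.comp
      (Computable.snd.comp (Computable.snd.comp Computable.fst))))

theorem wA_comp0 (f : ℕ → BStr → BStr → ℕ)
    (hf : Computable fun p : ℕ × BStr × BStr => f p.1 p.2.1 p.2.2) :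
    Computable (fun q : (ℕ × ℕ × ℕ) × BStr => f q.1.1 q.2 (natStr q.1.2.2)) := by
  have h := Computable.comp hf wA_comp1
  exact h

theorem wA_comp2 (M : CondSemimeasure) :
    Computable (fun q : (ℕ × ℕ × ℕ) × BStr => M.approx q.1.1 q.2 (natStr q.1.2.2)) :=
  wA_comp0 M.approx M.approx_computable

theorem wA_comp3 : Computable (fun q : ℕ × ℕ × ℕ => Encodable.decode₂ BStr q.2.1) :=
  Primrec.decode₂.to_comp.comp (Computable.fst.comp Computable.snd)

theorem wA_comp (M : CondSemimeasure) :
    Computable (fun q : ℕ × ℕ × ℕ => wA M q.1 q.2.1 q.2.2) := by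
  have h4 := Computable.option_casesOn wA_comp3 (Computable.const 0)
    (g := fun (q : ℕ × ℕ × ℕ) (y : BStr) => M.approx q.1 y (natStr q.2.2)) (wA_comp2 M).to₂
  refine h4.of_eq fun q => ?_
  unfold wA
  cases Encodable.decode₂ BStr q.2.1 <;> rfl

theorem wP_comp (M : CondSemimeasure) :
    Computable (fun q : ℕ × ℕ × ℕ × ℕ => wP M q.1 q.2.1 q.2.2.1 q.2.2.2) := by
  have hL : Primrec (fun q : ℕ × ℕ × ℕ × ℕ => q.1) := Primrec.fst
  have hs : Primrec (fun q : ℕ × ℕ × ℕ × ℕ => q.2.1) := Primrec.fst.comp Primrec.snd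
  have hn : Primrec (fun q : ℕ × ℕ × ℕ × ℕ => q.2.2.1) :=
    Primrec.fst.comp (Primrec.snd.comp Primrec.snd)
  have hj : Primrec (fun q : ℕ × ℕ × ℕ × ℕ => q.2.2.2) :=
    Primrec.snd.comp (Primrec.snd.comp Primrec.snd)
  have h1 : Primrec (fun q : ℕ × ℕ × ℕ × ℕ => (q.2.2.2 + 1) * 2 ^ q.2.1) :=
    Primrec.nat_mul.comp (Primrec.succ.comp hj) (wpow_primrec.comp (Primrec.const 2) hs)
  have ht : Primrec (fun q : ℕ × ℕ × ℕ × ℕ => (natStr (q.1 - 1)).length) :=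
    Primrec.list_length.comp (natStr_primrec.comp (Primrec.nat_sub.comp hL (Primrec.const 1)))
  have h2 : Computable (fun q : ℕ × ℕ × ℕ × ℕ =>
      wA M q.2.1 q.2.2.1 (natStr (q.1 - 1)).length * 2 ^ q.1) :=
    (Primrec.nat_mul.to_comp).comp
      (((wA_comp M).comp (hs.to_comp.pair (hn.to_comp.pair ht.to_comp))).of_eq (fun _ => rfl))
      (wpow_primrec.comp (Primrec.const 2) hL).to_comp
  have hle : Primrec₂ (fun a b : ℕ => decide (a ≤ b)) := Primrec.nat_le.decide
  exact (hle.to_comp.comp h1.to_comp h2).of_eq (fun _ => rfl)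

theorem wF_comp (M : CondSemimeasure) : Computable₂ (wF M) := by
  have hs : Primrec (fun q : ℕ × ℕ => q.2.unpair.1) :=
    Primrec.fst.comp (Primrec.unpair.comp Primrec.snd)
  have hr : Primrec (fun q : ℕ × ℕ => q.2.unpair.2.unpair) :=
    Primrec.unpair.comp (Primrec.snd.comp (Primrec.unpair.comp Primrec.snd))
  have hn := (Primrec.fst.comp hr).to_comp
  have hj := (Primrec.snd.comp hr).to_comp
  have h1 := (wP_comp M).comp (Computable.fst.pair (hs.to_comp.pair (hn.pair hj)))
  have h2 := (wP_comp M).comp (Computable.fst.pair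
    ((Primrec.nat_sub.comp hs (Primrec.const 1)).to_comp.pair (hn.pair hj)))
  have h0 : Primrec (fun q : ℕ × ℕ => decide (q.2.unpair.1 = 0)) :=
    Primrec.eq.decide.comp hs (Primrec.const 0)
  exact Primrec.and.to_comp.comp h1 (Primrec.or.to_comp.comp h0.to_comp (Primrec.not.to_comp.comp h2))

theorem wCount_comp (M : CondSemimeasure) : Computable₂ (wCount M) := by
  refine Computable.nat_rec (f := fun q : ℕ × ℕ => q.2) (g := fun _ => 0)
    (h := fun q r => r.2 + cond (wF M q.1 r.1) 1 0) Computable.snd (Computable.const 0) ?_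
  refine (Primrec.nat_add.to_comp.comp (Computable.snd.comp Computable.snd)
    (Computable.cond ((wF_comp M).comp (Computable.fst.comp Computable.fst)
      (Computable.fst.comp Computable.snd)) (Computable.const 1) (Computable.const 0))).to₂

theorem wOut_primrec : Primrec wOut := by
  have hr : Primrec (fun q : ℕ => q.unpair.2.unpair) :=
    Primrec.unpair.comp (Primrec.snd.comp Primrec.unpair)
  exact pairStr_primrec.comp
    (Primrec.option_getD.comp (Primrec.decode₂.comp (Primrec.fst.comp hr)) (Primrec.const []))
    (natStr_primrec.comp (Primrec.snd.comp hr))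

theorem wD_partrec (M : CondSemimeasure) : Partrec (wD M) := by
  have hl : Computable (fun q : BStr × ℕ => q.1.length) :=
    Computable.list_length.comp Computable.fst
  have ht : Computable₂ (wTest M) := by
    have he : Primrec₂ (fun a b : ℕ => decide (a = b)) := Primrec.eq.decide
    exact Primrec.and.to_comp.comp ((wF_comp M).comp hl Computable.snd)
      (he.to_comp.comp ((wCount_comp M).comp hl Computable.snd)
        (wIdx_primrec.to_comp.comp Computable.fst))
  exact Partrec.map (Partrec.rfind ht.partrec₂) (wOut_primrec.to_comp.comp Computable.snd).to₂

theorem wA_encode (M : CondSemimeasure) (s t : ℕ) (y : BStr) :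
    wA M s (Encodable.encode y) t = M.approx s y (natStr t) := by
  simp [wA, Encodable.decode₂_encode]

theorem wA_mono (M : CondSemimeasure) {s s' : ℕ} (n t : ℕ) (h : s ≤ s') :
    wA M s n t * 2 ^ s' ≤ wA M s' n t * 2 ^ s := by
  unfold wA
  cases Encodable.decode₂ BStr n with
  | none => simp
  | some y =>
    have := M.approx_mono y (natStr t) h
    simp only at this ⊢
    rw [ENNReal.div_le_iff (by positivity) (by simp), div_eq_mul_inv, mul_right_comm,
      ← div_eq_mul_inv, ENNReal.le_div_iff_mul_le (by simp) (by simp)] at this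
    exact_mod_cast this

theorem wP_mono (M : CondSemimeasure) {s s' : ℕ} (L n j : ℕ) (h : s ≤ s')
    (hp : wP M L s n j = true) : wP M L s' n j = true := by
  simp only [wP, decide_eq_true_eq] at hp ⊢
  have h1 := wA_mono M n (natStr (L - 1)).length h
  generalize wA M s n (natStr (L - 1)).length = A at *
  generalize wA M s' n (natStr (L - 1)).length = A' at *
  have h2 : ((j + 1) * 2 ^ s') * 2 ^ s ≤ (A' * 2 ^ L) * 2 ^ s := by
    calc ((j + 1) * 2 ^ s') * 2 ^ s = ((j + 1) * 2 ^ s) * 2 ^ s' := by ring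
      _ ≤ (A * 2 ^ L) * 2 ^ s' := Nat.mul_le_mul_right _ hp
      _ = (A * 2 ^ s') * 2 ^ L := by ring
      _ ≤ (A' * 2 ^ s) * 2 ^ L := Nat.mul_le_mul_right _ h1
      _ = _ := by ring
  exact Nat.le_of_mul_le_mul_right h2 (by positivity)

theorem wF_aux (M : CondSemimeasure) (L : ℕ) {a b : ℕ} (ha : wF M L a = true)
    (hb : wF M L b = true) (h : a.unpair.2 = b.unpair.2) : ¬ a.unpair.1 < b.unpair.1 := by
  intro hlt
  simp only [wF, Bool.and_eq_true, Bool.or_eq_true, decide_eq_true_eq, Bool.not_eq_true'] at ha hb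
  rcases hb.2 with h0 | h0
  · omega
  · have := wP_mono M L _ _ (Nat.le_sub_one_of_lt hlt) ha.1
    rw [h, h0] at this
    exact Bool.noConfusion this

theorem wF_inj (M : CondSemimeasure) (L : ℕ) {a b : ℕ} (ha : wF M L a = true)
    (hb : wF M L b = true) (h : a.unpair.2 = b.unpair.2) : a = b := by
  have h1 := wF_aux M L ha hb h
  have h2 := wF_aux M L hb ha h.symm
  rw [← Nat.pair_unpair a, ← Nat.pair_unpair b, h, show a.unpair.1 = b.unpair.1 by omega]

theorem wA_sum (M : CondSemimeasure) (S t k : ℕ) : ∑ n ∈ Finset.range k, wA M S n t ≤ 2 ^ S := by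
  have h1 : (∑ n ∈ Finset.range k, (wA M S n t : ℝ≥0∞) / 2 ^ S) ≤ 1 := by
    calc _ ≤ ∑' n, (wA M S n t : ℝ≥0∞) / 2 ^ S := ENNReal.sum_le_tsum _
      _ = ∑' y : BStr, (wA M S (Encodable.encode y) t : ℝ≥0∞) / 2 ^ S := by
        symm
        refine (Encodable.encode_injective (α := BStr)).tsum_eq
          (f := fun n => (wA M S n t : ℝ≥0∞) / 2 ^ S) ?_
        intro n hn
        rcases hd : Encodable.decode₂ BStr n with _ | y
        · simp [wA, hd] at hn
        · exact ⟨y, Encodable.mem_decode₂.1 hd⟩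
      _ ≤ ∑' y : BStr, M.μ y (natStr t) := by
        refine ENNReal.tsum_le_tsum fun y => ?_
        rw [wA_encode, ← M.approx_sup]
        exact le_iSup (fun s => (M.approx s y (natStr t) : ℝ≥0∞) / 2 ^ s) S
      _ ≤ 1 := M.sum_le_one _
  simp only [div_eq_mul_inv] at h1
  rw [← Finset.sum_mul, ← div_eq_mul_inv, ENNReal.div_le_iff (by positivity) (by simp), one_mul] at h1
  exact_mod_cast h1

theorem wCount_succ (M : CondSemimeasure) (L a : ℕ) :
    wCount M L (a + 1) = wCount M L a + cond (wF M L a) 1 0 := rfl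

theorem wCount_card (M : CondSemimeasure) (L a : ℕ) :
    wCount M L a = ((Finset.range a).filter (fun b => wF M L b = true)).card := by
  induction a with
  | zero => rfl
  | succ a ih =>
    rw [wCount_succ, ih, Finset.range_add_one, Finset.filter_insert]
    cases h : wF M L a <;> simp

theorem wCount_mono (M : CondSemimeasure) (L : ℕ) : Monotone (wCount M L) :=
  monotone_nat_of_le_succ fun a => by rw [wCount_succ]; omega

theorem wCount_le (M : CondSemimeasure) (L a : ℕ) : wCount M L a ≤ 2 ^ L := by
  rw [wCount_card]
  set t := (natStr (L - 1)).length with ht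
  have h1 : ((Finset.range a).filter (fun b => wF M L b = true)).card ≤
      ((Finset.range a).sigma (fun n => Finset.range (wA M a n t * 2 ^ L / 2 ^ a))).card := by
    refine Finset.card_le_card_of_injOn
      (fun b => (⟨b.unpair.2.unpair.1, b.unpair.2.unpair.2⟩ : Σ _ : ℕ, ℕ)) ?_ ?_
    · intro b hb
      simp only [Finset.coe_filter, Finset.mem_range, Set.mem_ofPred_eq] at hb
      simp only [Finset.coe_sigma, Set.mem_sigma_iff, Finset.coe_range, Set.mem_Iio]
      refine ⟨((Nat.unpair_left_le _).trans (Nat.unpair_right_le _)).trans_lt hb.1, ?_⟩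
      have hp : wP M L b.unpair.1 b.unpair.2.unpair.1 b.unpair.2.unpair.2 = true := by
        have := hb.2
        simp only [wF, Bool.and_eq_true] at this
        exact this.1
      have hp2 := wP_mono M L _ _ ((Nat.unpair_left_le b).trans hb.1.le) hp
      simp only [wP, decide_eq_true_eq] at hp2
      exact (Nat.le_div_iff_mul_le (by positivity)).2 hp2
    · intro b hb b' hb' h
      simp only [Finset.coe_filter, Finset.mem_range, Set.mem_ofPred_eq] at hb hb'
      simp only [Sigma.mk.injEq, heq_eq_eq] at h
      refine wF_inj M L hb.2 hb'.2 ?_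
      rw [← Nat.pair_unpair b.unpair.2, h.1, h.2, Nat.pair_unpair]
  refine h1.trans ?_
  rw [Finset.card_sigma]
  simp only [Finset.card_range]
  refine Nat.le_of_mul_le_mul_right (c := 2 ^ a) ?_ (by positivity)
  rw [Finset.sum_mul]
  calc _ ≤ ∑ n ∈ Finset.range a, wA M a n t * 2 ^ L :=
        Finset.sum_le_sum fun n _ => Nat.div_mul_le_self _ _
    _ = (∑ n ∈ Finset.range a, wA M a n t) * 2 ^ L := by rw [Finset.sum_mul]
    _ ≤ 2 ^ a * 2 ^ L := Nat.mul_le_mul_right _ (wA_sum M a t a)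
    _ = _ := mul_comm _ _

theorem wD_spec (M : CondSemimeasure) (L a : ℕ) (ha : wF M L a = true) :
    ∃ p : BStr, p.length = L ∧ wOut a ∈ wD M p := by
  have h1 : wCount M L a < 2 ^ L := by
    have := wCount_le M L (a + 1)
    rw [wCount_succ, ha] at this
    exact this
  obtain ⟨p, hp, hi⟩ := wIdx_surj L _ h1
  refine ⟨p, hp, ?_⟩
  refine (Part.mem_map_iff _).2 ⟨a, Nat.mem_rfind.2 ⟨?_, ?_⟩, rfl⟩
  · rw [Part.mem_some_iff]
    simp [wTest, hp, ha, hi]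
  · intro b hb
    rw [Part.mem_some_iff]
    symm
    by_contra h
    simp only [wTest, hp, hi, Bool.not_eq_false, Bool.and_eq_true, decide_eq_true_eq] at h
    have h2 := wCount_mono M L (Nat.succ_le_of_lt hb)
    rw [Nat.succ_eq_add_one, wCount_succ, h.1] at h2
    simp at h2
    omega

theorem wD_pair (M : CondSemimeasure) (L s j : ℕ) (y : BStr)
    (h : wP M L s (Encodable.encode y) j = true) :
    ∃ p : BStr, p.length = L ∧ pairStr y (natStr j) ∈ wD M p := by
  have hex : ∃ s, wP M L s (Encodable.encode y) j = true := ⟨s, h⟩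
  have hF : wF M L (Nat.pair (Nat.find hex) (Nat.pair (Encodable.encode y) j)) = true := by
    simp only [wF, Nat.unpair_pair, Bool.and_eq_true, Bool.or_eq_true, decide_eq_true_eq,
      Bool.not_eq_true']
    refine ⟨Nat.find_spec hex, ?_⟩
    by_cases h0 : Nat.find hex = 0
    · exact Or.inl h0
    · exact Or.inr (by simpa using Nat.find_min hex (m := Nat.find hex - 1) (by omega))
  have := wD_spec M L _ hF
  simpa [wOut, Encodable.decode₂_encode] using this

theorem plainC_le {D : BStr →. BStr} {x p : BStr} (h : x ∈ D p) : plainC D x ≤ p.length :=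
  Nat.sInf_le ⟨p, rfl, h⟩

theorem Tset_finite (O : OptimalDecompressor) (t : ℕ) (y : BStr) : (Tset O t y).Finite := by
  have hfin : {p : BStr | p.length ≤ 2 ^ t}.Finite := List.finite_length_le Bool (2 ^ t)
  have hch : ∀ s ∈ Tset O t y, ∃ p : BStr, p.length ≤ 2 ^ t ∧ pairStr y s ∈ O.V p := by
    intro s hs
    obtain ⟨p0, hp0⟩ := O.onto (pairStr y s)
    obtain ⟨p, hp, hm⟩ := Nat.sInf_mem
      (s := {n | ∃ p : BStr, p.length = n ∧ pairStr y s ∈ O.V p}) ⟨_, p0, rfl, hp0⟩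
    exact ⟨p, hp.le.trans hs, hm⟩
  choose! f hf1 hf2 using hch
  refine Set.Finite.of_finite_image (f := f) (hfin.subset ?_) ?_
  · rintro _ ⟨s, hs, rfl⟩
    exact hf1 s hs
  · intro s hs s' hs' h
    have h1 := hf2 s hs
    rw [h] at h1
    exact (pairStr_inj (Part.mem_unique h1 (hf2 s' hs'))).2

/-- There is a constant `c` such that for every integer `t` and
every string (or tuple) `y` with `|y| < 2^t/2 − c`:
`m(y | t) ≤ c · |T_t(y)| · 2^{−2^t}`, where `T_t(y) = {s : C_V(y, s) ≤ 2^t}`. -/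
theorem measure_le_extension_density
    (O : OptimalDecompressor) (M : UniversalCondSemimeasure) :
    ∃ c : ℕ, 0 < c ∧ ∀ t : ℕ, ∀ y : BStr, 2 * (y.length + c) < 2 ^ t →
      M.μ y (natStr t) ≤ (c : ℝ≥0∞) * ((Tset O t y).ncard : ℝ≥0∞) / 2 ^ (2 ^ t) := by
  obtain ⟨M1, hM1⟩ := O.optimal (wD M.toCondSemimeasure) (wD_partrec _)
  have hD2 : Computable (fun y : BStr => pairStr y []) :=
    (pairStr_primrec.comp Primrec.id (Primrec.const [])).to_comp
  obtain ⟨M2, hM2⟩ := O.optimal (fun y => Part.some (pairStr y [])) hD2.partrec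
  refine ⟨M1 + M2 + 2 ^ (M1 + 1) + 1, by positivity, fun t y hty => ?_⟩
  have hfin := Tset_finite O t y
  set N := (Tset O t y).ncard with hN
  have hpw : 0 < 2 ^ M1 := by positivity
  have hM1t : 2 * (M1 + 1) < 2 ^ t := by omega
  have hpos : 1 ≤ N := by
    refine (Set.ncard_pos hfin).2 ⟨[], ?_⟩
    have h1 := hM2 (pairStr y []) ⟨y, Part.mem_some _⟩
    have h2 : plainC (fun y => Part.some (pairStr y [])) (pairStr y []) ≤ y.length :=
      plainC_le (Part.mem_some _)
    show plainC O.V (pairStr y []) ≤ 2 ^ t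
    omega
  obtain ⟨L, hL⟩ : ∃ L, L + M1 = 2 ^ t := ⟨2 ^ t - M1, by omega⟩
  have hsize : (natStr (L - 1)).length = t := by
    rw [natStr, Nat.size_eq_bits_len]
    apply le_antisymm
    · rw [Nat.size_le]; omega
    · cases t with
      | zero => simp
      | succ t =>
        rw [Nat.succ_le_iff, Nat.lt_size]
        rw [pow_succ] at hL hM1t
        omega
  have key : M.μ y (natStr t) ≤ ((N : ℝ≥0∞) + 1) / 2 ^ L := by
    by_contra hlt
    rw [not_le, ← M.approx_sup, lt_iSup_iff] at hlt
    obtain ⟨s, hs⟩ := hlt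
    rw [ENNReal.div_lt_iff (Or.inl (by positivity)) (Or.inl (by simp)), div_eq_mul_inv,
      mul_right_comm, ← div_eq_mul_inv,
      ENNReal.lt_div_iff_mul_lt (Or.inl (by simp)) (Or.inl (by simp))] at hs
    have hs' : (N + 1) * 2 ^ s < M.approx s y (natStr t) * 2 ^ L := by exact_mod_cast hs
    have hsub : natStr '' (Set.Iio (N + 1)) ⊆ Tset O t y := by
      rintro _ ⟨j, hj, rfl⟩
      have hP : wP M.toCondSemimeasure L s (Encodable.encode y) j = true := by
        simp only [wP, decide_eq_true_eq, hsize, wA_encode]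
        exact (Nat.mul_le_mul_right _ (Nat.succ_le_of_lt hj)).trans hs'.le
      obtain ⟨p, hp, hm⟩ := wD_pair _ _ _ _ _ hP
      have h1 := hM1 _ ⟨p, hm⟩
      have h2 := plainC_le hm
      show plainC O.V (pairStr y (natStr j)) ≤ 2 ^ t
      omega
    have := Set.ncard_le_ncard hsub hfin
    rw [Set.ncard_image_of_injective _ natStr_inj] at this
    have hc : (Set.Iio (N + 1)).ncard = N + 1 := by
      rw [← Finset.coe_Iio, Set.ncard_coe_finset, Nat.card_Iio]
    omega
  refine key.trans ?_
  rw [← hL, ENNReal.div_le_iff (by positivity) (by simp), div_eq_mul_inv, mul_right_comm,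
    ← div_eq_mul_inv, ENNReal.le_div_iff_mul_le (by simp) (by simp)]
  have hnat : (N + 1) * 2 ^ (L + M1) ≤ (M1 + M2 + 2 ^ (M1 + 1) + 1) * N * 2 ^ L := by
    calc (N + 1) * 2 ^ (L + M1) ≤ (2 * N) * 2 ^ (L + M1) := Nat.mul_le_mul_right _ (by omega)
      _ = 2 ^ (M1 + 1) * N * 2 ^ L := by ring
      _ ≤ _ := Nat.mul_le_mul_right _ (Nat.mul_le_mul_right _ (by omega))
  exact_mod_cast hnat
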